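/- arXiv:1002.1602 — 7 statements merged into one kernel-verified Lean document; each statement's English description precedes it below -/
import Mathlib

section
/- Let X be a first countable topological space, F a Fréchet space (a complete metrizable locally convex topological vector space), and V a topological vector space. Let α : X → L(F,V) be a map into the continuous linear operators from F to V such that, for each f ∈ F, the map X → V, x ↦ α(x)f is continuous. Then the map X × F → V, (x,f) ↦ α(x)f is continuous. -/
/-- If `X` is first countable, `F` a Fréchet space (complete metrizable
locally convex TVS over `ℝ`), `V` a topological vector space, and `α : X → L(F,V)` is such
that `x ↦ α x f` is continuous for each `f`, then `(x, f) ↦ α x f` is continuous. -/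
theorem stmt1
    {X : Type*} [TopologicalSpace X] [FirstCountableTopology X]
    {F : Type*} [AddCommGroup F] [Module ℝ F] [UniformSpace F] [IsUniformAddGroup F]
    [ContinuousSMul ℝ F] [LocallyConvexSpace ℝ F] [CompleteSpace F]
    [TopologicalSpace.MetrizableSpace F]
    {V : Type*} [AddCommGroup V] [Module ℝ V] [TopologicalSpace V]
    [IsTopologicalAddGroup V] [ContinuousSMul ℝ V]
    (α : X → F →L[ℝ] V)
    (hα : ∀ f : F, Continuous fun x : X => α x f) :
    Continuous fun p : X × F => α p.1 p.2 := by
  have : (uniformity F).IsCountablyGenerated :=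
    IsUniformAddGroup.uniformity_countably_generated
  apply SeqContinuous.continuous
  intro u p hu
  have hx : Filter.Tendsto (fun n => (u n).1) Filter.atTop (nhds p.1) :=
    (continuous_fst.tendsto p).comp hu
  have hf : Filter.Tendsto (fun n => (u n).2) Filter.atTop (nhds p.2) :=
    (continuous_snd.tendsto p).comp hu
  have hpt : ∀ g : F, Filter.Tendsto (fun n => α (u n).1 g) Filter.atTop (nhds (α p.1 g)) :=
    fun g => ((hα g).tendsto p.1).comp hx
  -- it suffices to treat null sequences in `F`
  have key : Filter.Tendsto (fun n => α (u n).1 ((u n).2 - p.2)) Filter.atTop (nhds 0) := by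
    rw [Filter.tendsto_def]
    intro U hU
    obtain ⟨W₀, hW₀, hW₀U⟩ : ∃ W₀ ∈ nhds (0 : V), ∀ v ∈ W₀, ∀ w ∈ W₀, v - w ∈ U :=
      exists_nhds_half_neg hU
    obtain ⟨W, hW, hWc, hWW₀⟩ := exists_mem_nhds_isClosed_subset hW₀
    let A : ℕ → Set F := fun k => {g | ∀ n, k ≤ n → ((k : ℝ) + 1)⁻¹ • α (u n).1 g ∈ W}
    have hAc : ∀ k, IsClosed (A k) := by
      intro k
      have : A k = ⋂ n, ⋂ (_ : k ≤ n), {g | ((k : ℝ) + 1)⁻¹ • α (u n).1 g ∈ W} := by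
        ext g; simp [A]
      rw [this]
      refine isClosed_iInter fun n => isClosed_iInter fun _ => ?_
      exact hWc.preimage ((α (u n).1).continuous.const_smul _)
    have hAU : ⋃ k, A k = Set.univ := by
      rw [Set.eq_univ_iff_forall]
      intro g
      have h1 : Filter.Tendsto (fun k : ℕ => ((k : ℝ) + 1)⁻¹) Filter.atTop (nhds 0) := by
        simpa [one_div] using tendsto_one_div_add_atTop_nhds_zero_nat (𝕜 := ℝ)
      have h2 : Filter.Tendsto (fun q : ℕ × ℕ => ((q.1 : ℝ) + 1)⁻¹ • α (u q.2).1 g)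
          Filter.atTop (nhds 0) := by
        rw [← Filter.prod_atTop_atTop_eq]
        have := (h1.comp (Filter.tendsto_fst (f := Filter.atTop) (g := Filter.atTop (α := ℕ)))).smul
          ((hpt g).comp (Filter.tendsto_snd (f := Filter.atTop (α := ℕ)) (g := Filter.atTop)))
        simpa using this
      obtain ⟨⟨a, b⟩, hab⟩ := Filter.eventually_atTop.1 (h2.eventually hW)
      refine Set.mem_iUnion.2 ⟨max a b, fun n hn => ?_⟩
      exact hab (max a b, n) ⟨le_max_left _ _, (le_max_right _ _).trans hn⟩
    obtain ⟨k, g₀, hg₀⟩ := nonempty_interior_of_iUnion_of_closed hAc hAU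
    have hN : A k ∈ nhds g₀ := mem_interior_iff_mem_nhds.1 hg₀
    have hlim : Filter.Tendsto (fun n => g₀ + ((k : ℝ) + 1) • ((u n).2 - p.2))
        Filter.atTop (nhds g₀) := by
      have := ((hf.sub_const p.2).const_smul ((k : ℝ) + 1)).const_add g₀
      simpa using this
    have hk : ((k : ℝ) + 1) ≠ 0 := by positivity
    filter_upwards [hlim.eventually hN, Filter.eventually_ge_atTop k] with n hn hkn
    have e := hW₀U _ (hWW₀ (hn n hkn)) _ (hWW₀ (mem_of_mem_nhds hN n hkn))
    rw [map_add, map_smul, smul_add, smul_smul, inv_mul_cancel₀ hk, one_smul,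
      add_sub_cancel_left] at e
    exact e
  have := key.add (hpt p.2)
  simpa [Function.comp_def] using this
end

section
/- Let H be a real Hilbert space and γ : ℝ → H a map such that the function K : ℝ × ℝ → ℝ, K(t,s) := ⟨γ(t), γ(s)⟩, is smooth (C^∞). Then γ is a smooth curve; moreover, its derivative satisfies ⟨γ'(t), γ(s)⟩ = (∂₁K)(t,s) and ‖γ'(t)‖² = (∂₁∂₂K)(t,t) for all t,s ∈ ℝ. -/
/-- Two-variable mean value estimate. -/
theorem stmt7_aux_mvt (K A B : ℝ × ℝ → ℝ)
    (hA : ∀ x y, HasDerivAt (fun a => K (a, y)) (A (x, y)) x)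
    (hB : ∀ x y, HasDerivAt (fun b => A (x, b)) (B (x, y)) y)
    (t L ε δ : ℝ)
    (hb : ∀ x ∈ Metric.ball t δ, ∀ y ∈ Metric.ball t δ, |B (x, y) - L| ≤ ε)
    (x y : ℝ) (hx : x ∈ Metric.ball t δ) (hy : y ∈ Metric.ball t δ) :
    |K (x, y) - K (x, t) - K (t, y) + K (t, t) - L * ((x - t) * (y - t))|
      ≤ ε * |y - t| * |x - t| := by
  have hδ : 0 < δ := lt_of_le_of_lt dist_nonneg (Metric.mem_ball.1 hx)
  have ht : t ∈ Metric.ball t δ := Metric.mem_ball_self hδ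
  have h1 : ∀ u ∈ Metric.ball t δ, |(A (u, y) - L * y) - (A (u, t) - L * t)| ≤ ε * |y - t| := by
    intro u hu
    have := (convex_ball t δ).norm_image_sub_le_of_norm_hasDerivWithin_le
      (f := fun b => A (u, b) - L * b) (f' := fun b => B (u, b) - L * 1) (C := ε)
      (fun b _ => ((hB u b).sub ((hasDerivAt_id b).const_mul L)).hasDerivWithinAt)
      (fun b hb' => by simpa using hb u hu b hb') ht hy
    simpa using this
  have h2 := (convex_ball t δ).norm_image_sub_le_of_norm_hasDerivWithin_le
      (f := fun a => K (a, y) - K (a, t) - L * (y - t) * a)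
      (f' := fun a => A (a, y) - A (a, t) - L * (y - t) * 1) (C := ε * |y - t|)
      (fun a _ => (((hA a y).sub (hA a t)).sub
        ((hasDerivAt_id a).const_mul (L * (y - t)))).hasDerivWithinAt)
      (fun a ha => by
        have := h1 a ha
        rw [Real.norm_eq_abs]
        convert this using 2
        ring) ht hx
  rw [Real.norm_eq_abs, Real.norm_eq_abs] at h2
  convert h2 using 2
  ring

theorem stmt7_aux_partial (K : ℝ × ℝ → ℝ) (hK : ContDiff ℝ (⊤ : ℕ∞) K) :
    ∃ A B : ℝ × ℝ → ℝ, ContDiff ℝ (⊤ : ℕ∞) B ∧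
      (∀ x y, HasDerivAt (fun a => K (a, y)) (A (x, y)) x) ∧
      (∀ x y, HasDerivAt (fun b => A (x, b)) (B (x, y)) y) := by
  have hs : ∀ (F : ℝ × ℝ → ℝ) (v : ℝ × ℝ), ContDiff ℝ (⊤ : ℕ∞) F →
      ContDiff ℝ (⊤ : ℕ∞) (fun p => fderiv ℝ F p v) := by
    intro F v hF
    exact (hF.fderiv_right (m := (⊤ : ℕ∞)) (by simp)).clm_apply contDiff_const
  have hd : ∀ (F : ℝ × ℝ → ℝ), ContDiff ℝ (⊤ : ℕ∞) F → Differentiable ℝ F :=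
    fun F hF => hF.differentiable (by simp)
  refine ⟨fun p => fderiv ℝ K p (1, 0),
    fun p => fderiv ℝ (fun p => fderiv ℝ K p (1, 0)) p (0, 1), hs _ _ (hs _ _ hK), ?_, ?_⟩
  · intro x y
    exact (hd _ hK (x, y)).hasFDerivAt.comp_hasDerivAt x
      ((hasDerivAt_id x).prodMk (hasDerivAt_const x y))
  · intro x y
    exact (hd _ (hs _ (1, 0) hK) (x, y)).hasFDerivAt.comp_hasDerivAt y
      ((hasDerivAt_const y x).prodMk (hasDerivAt_id y))

theorem stmt7_aux_diff
    {H : Type*} [NormedAddCommGroup H] [InnerProductSpace ℝ H] [CompleteSpace H]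
    (γ : ℝ → H) (A B : ℝ × ℝ → ℝ) (hBc : Continuous B)
    (hA : ∀ x y, HasDerivAt (fun a => (inner ℝ (γ a) (γ y) : ℝ)) (A (x, y)) x)
    (hB : ∀ x y, HasDerivAt (fun b => A (x, b)) (B (x, y)) y) :
    Differentiable ℝ γ := by
  intro t
  have hc : Cauchy (Filter.map (slope γ t) (nhdsWithin t {t}ᶜ)) := by
    rw [Metric.cauchy_iff]
    refine ⟨inferInstance, fun e he => ?_⟩
    obtain ⟨δ, hδ, hb⟩ := Metric.continuousAt_iff.1 (hBc.continuousAt (x := (t, t)))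
      (e ^ 2 / 5) (by positivity)
    have hb' : ∀ x ∈ Metric.ball t δ, ∀ y ∈ Metric.ball t δ,
        |B (x, y) - B (t, t)| ≤ e ^ 2 / 5 := by
      intro x hx y hy
      have := hb (x := (x, y)) (by
        rw [Prod.dist_eq]; exact max_lt (Metric.mem_ball.1 hx) (Metric.mem_ball.1 hy))
      exact (Real.dist_eq _ _ ▸ this).le
    have key : ∀ x ∈ Metric.ball t δ ∩ {t}ᶜ, ∀ y ∈ Metric.ball t δ ∩ {t}ᶜ,
        |inner ℝ (slope γ t x) (slope γ t y) - B (t, t)| ≤ e ^ 2 / 5 := by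
      intro x hx y hy
      have h := stmt7_aux_mvt (fun p => (inner ℝ (γ p.1) (γ p.2) : ℝ)) A B hA hB t (B (t, t))
        (e ^ 2 / 5) δ hb' x y hx.1 hy.1
      have hx0 : x - t ≠ 0 := sub_ne_zero.2 hx.2
      have hy0 : y - t ≠ 0 := sub_ne_zero.2 hy.2
      have hpos : 0 < |x - t| * |y - t| := by positivity
      refine le_of_mul_le_mul_right ?_ hpos
      rw [← abs_mul (x - t), ← abs_mul (inner ℝ (slope γ t x) (slope γ t y) - B (t, t)),
        abs_mul (x - t) (y - t)]
      have e1 : (inner ℝ (slope γ t x) (slope γ t y) - B (t, t)) * ((x - t) * (y - t))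
          = inner ℝ (γ x) (γ y) - inner ℝ (γ x) (γ t) - inner ℝ (γ t) (γ y)
            + inner ℝ (γ t) (γ t) - B (t, t) * ((x - t) * (y - t)) := by
        have e2 : (inner ℝ (slope γ t x) (slope γ t y) : ℝ)
            = (x - t)⁻¹ * ((y - t)⁻¹ * inner ℝ (γ x - γ t) (γ y - γ t)) := by
          simp only [slope_def_module, real_inner_smul_left, real_inner_smul_right]
          ring
        rw [e2, inner_sub_left, inner_sub_right, inner_sub_right]
        field_simp
        ring
      rw [e1]
      refine h.trans (le_of_eq ?_)
      ring
    refine ⟨Set.image (slope γ t) (Metric.ball t δ ∩ {t}ᶜ), Filter.image_mem_map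
      (Filter.inter_mem (mem_nhdsWithin_of_mem_nhds (Metric.ball_mem_nhds t hδ)) self_mem_nhdsWithin), ?_⟩
    rintro _ ⟨x, hx, rfl⟩ _ ⟨y, hy, rfl⟩
    rw [dist_eq_norm]
    refine lt_of_pow_lt_pow_left₀ 2 he.le ?_
    rw [norm_sub_sq_real, ← real_inner_self_eq_norm_sq, ← real_inner_self_eq_norm_sq]
    have h1 := abs_le.1 (key x hx x hx)
    have h2 := abs_le.1 (key x hx y hy)
    have h3 := abs_le.1 (key y hy y hy)
    have : 0 < e ^ 2 := by positivity
    linarith [h1.2, h2.1, h3.2]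
  obtain ⟨v, hv⟩ := cauchy_map_iff_exists_tendsto.1 hc
  exact (hasDerivAt_iff_tendsto_slope.2 hv).differentiableAt

theorem stmt7_aux_main
    {H : Type*} [NormedAddCommGroup H] [InnerProductSpace ℝ H] [CompleteSpace H]
    (γ : ℝ → H)
    (hK : ContDiff ℝ (⊤ : ℕ∞) fun p : ℝ × ℝ => (inner ℝ (γ p.1) (γ p.2) : ℝ)) :
    Differentiable ℝ γ ∧
    ContDiff ℝ (⊤ : ℕ∞) fun p : ℝ × ℝ => (inner ℝ (deriv γ p.1) (deriv γ p.2) : ℝ) := by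
  obtain ⟨A, B, hBs, hA, hB⟩ := stmt7_aux_partial _ hK
  have hd : Differentiable ℝ γ := stmt7_aux_diff γ A B hBs.continuous hA hB
  refine ⟨hd, ?_⟩
  have hA' : ∀ x y, A (x, y) = inner ℝ (deriv γ x) (γ y) := fun x y =>
    (hA x y).unique (by
      simpa using (hd x).hasDerivAt.inner ℝ (hasDerivAt_const x (γ y)))
  have hB' : ∀ x y, B (x, y) = inner ℝ (deriv γ x) (deriv γ y) := fun x y =>
    (hB x y).unique (by
      simp only [hA']
      simpa using (hasDerivAt_const y (deriv γ x)).inner ℝ (hd y).hasDerivAt)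
  convert hBs using 1
  ext ⟨x, y⟩
  exact (hB' x y).symm

theorem stmt7_aux_nat
    {H : Type*} [NormedAddCommGroup H] [InnerProductSpace ℝ H] [CompleteSpace H] (n : ℕ) :
    ∀ (γ : ℝ → H)
    (_ : ContDiff ℝ (⊤ : ℕ∞) fun p : ℝ × ℝ => (inner ℝ (γ p.1) (γ p.2) : ℝ)),
    ContDiff ℝ n γ := by
  induction n with
  | zero => exact fun γ hK => contDiff_zero.2 (stmt7_aux_main γ hK).1.continuous
  | succ n ih =>
    intro γ hK
    obtain ⟨hd, hK'⟩ := stmt7_aux_main γ hK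
    push_cast
    exact contDiff_succ_iff_deriv.2 ⟨hd, by simp, ih _ hK'⟩


/-- If `γ : ℝ → H` is a map into a real Hilbert space such that
`K(t,s) = ⟨γ t, γ s⟩` is smooth on `ℝ × ℝ`, then `γ` is a smooth curve; moreover
`⟨γ'(t), γ(s)⟩ = (∂₁K)(t,s)` and `‖γ'(t)‖² = (∂₁∂₂K)(t,t)` for all `t, s`. -/
theorem stmt7
    {H : Type*} [NormedAddCommGroup H] [InnerProductSpace ℝ H] [CompleteSpace H]
    (γ : ℝ → H)
    (hK : ContDiff ℝ (⊤ : ℕ∞) fun p : ℝ × ℝ => (inner ℝ (γ p.1) (γ p.2) : ℝ)) :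
    ContDiff ℝ (⊤ : ℕ∞) γ ∧
      (∀ t s : ℝ, (inner ℝ (deriv γ t) (γ s) : ℝ) =
        deriv (fun a : ℝ => (inner ℝ (γ a) (γ s) : ℝ)) t) ∧
      (∀ t : ℝ, ‖deriv γ t‖ ^ 2 =
        deriv (fun a : ℝ => deriv (fun b : ℝ => (inner ℝ (γ a) (γ b) : ℝ)) t) t) := by
  have hd := (stmt7_aux_main γ hK).1
  refine ⟨contDiff_infty.2 fun n => stmt7_aux_nat n γ hK, fun t s => ?_, fun t => ?_⟩
  · have h := (hd t).hasDerivAt.inner ℝ (hasDerivAt_const t (γ s))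
    simpa using h.deriv.symm
  · have h1 : ∀ a, deriv (fun b : ℝ => (inner ℝ (γ a) (γ b) : ℝ)) t
        = inner ℝ (γ a) (deriv γ t) := by
      intro a
      have h := (hasDerivAt_const t (γ a)).inner ℝ (hd t).hasDerivAt
      simpa using h.deriv
    simp only [h1]
    have h := (hd t).hasDerivAt.inner ℝ (hasDerivAt_const t (deriv γ t))
    rw [h.deriv]
    simp
end

section
/- Let 1 ≤ r < 2 and ξ ∈ L²([0,1],ℂ). If the pointwise product f·ξ lies in L²([0,1],ℂ) for every f ∈ L^r([0,1],ℝ), then ξ = 0 almost everywhere. -/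
open MeasureTheory
open scoped ENNReal

lemma aux_sub {A : Set (Set.Icc (0:ℝ) 1)} (hA : MeasurableSet A)
    (h : (volume : Measure (Set.Icc (0:ℝ) 1)) A ≠ 0) (δ : ℝ) (hδ : 0 < δ) :
    ∃ B ⊆ A, MeasurableSet B ∧ 0 < (volume : Measure (Set.Icc (0:ℝ) 1)).real B ∧
      (volume : Measure (Set.Icc (0:ℝ) 1)).real B < δ := by
  obtain ⟨x, hx, hpos⟩ := exists_mem_forall_mem_nhdsWithin_pos_measure h
  have h0 : (volume : Measure (Set.Icc (0:ℝ) 1)) {x} = 0 := by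
    rw [Measure.Subtype.volume_def, Measure.comap_apply _ Subtype.val_injective
      (fun s hs => (measurableSet_Icc.subtype_image hs)) _ (measurableSet_singleton x)]
    simp
  obtain ⟨U, hU, hUo, hUlt⟩ := Set.exists_isOpen_lt_of_lt {x} (ENNReal.ofReal δ)
    (by rw [h0]; simpa using hδ)
  refine ⟨A ∩ U, Set.inter_subset_left, hA.inter hUo.measurableSet, ?_, ?_⟩
  · refine ENNReal.toReal_pos (hpos _ ?_).ne' (measure_ne_top _ _)
    exact Filter.inter_mem self_mem_nhdsWithin (mem_nhdsWithin_of_mem_nhds (hUo.mem_nhds (hU rfl)))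
  · refine (ENNReal.lt_ofReal_iff_toReal_lt (measure_ne_top _ _)).1 ?_
    exact (measure_mono Set.inter_subset_right).trans_lt hUlt

theorem stmt13
    (r : ℝ) (hr1 : 1 ≤ r) (hr2 : r < 2)
    (ξ : Set.Icc (0:ℝ) 1 → ℂ)
    (hξ : MemLp ξ 2 (volume : Measure (Set.Icc (0:ℝ) 1)))
    (hmul : ∀ f : Set.Icc (0:ℝ) 1 → ℝ,
        MemLp f (ENNReal.ofReal r) (volume : Measure (Set.Icc (0:ℝ) 1)) →
        MemLp (fun x => (f x : ℂ) * ξ x) 2 (volume : Measure (Set.Icc (0:ℝ) 1))) :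
    ξ =ᵐ[(volume : Measure (Set.Icc (0:ℝ) 1))] 0 := by
  set μ : Measure (Set.Icc (0:ℝ) 1) := volume with hμ
  set η := hξ.1.mk ξ with hη
  have hηm : StronglyMeasurable η := hξ.1.stronglyMeasurable_mk
  have hξη : ξ =ᵐ[μ] η := hξ.1.ae_eq_mk
  refine hξη.trans ?_
  have key : ∀ k : ℕ, μ {x | 1 / ((k:ℝ) + 1) < ‖η x‖} = 0 := by
    intro k
    by_contra hne
    set ε : ℝ := 1 / ((k:ℝ) + 1) with hε
    have hε0 : 0 < ε := by positivity
    have hAm : MeasurableSet {x | ε < ‖η x‖} :=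
      measurableSet_lt measurable_const hηm.measurable.norm
    have hr0 : 0 < r := by linarith
    set a : ℝ := 1 / r - 1 / 2 with ha
    have ha0 : 0 < a := by
      rw [ha, sub_pos]; exact one_div_lt_one_div_of_lt hr0 hr2
    have hB := fun n : ℕ => aux_sub hAm hne (((1/2:ℝ)^n / (n+1)) ^ (1/a)) (by positivity)
    choose B hBA hBm hB0 hBlt using hB
    have : Fact (1 ≤ ENNReal.ofReal r) := ⟨by simpa using hr1⟩
    set c : ℕ → ℝ := fun n => (n+1) * (μ.real (B n)) ^ (-(1/2:ℝ)) with hc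
    have hc0 : ∀ n, 0 ≤ c n := fun n => by positivity
    let g : ℕ → Lp ℝ (ENNReal.ofReal r) μ := fun n =>
      indicatorConstLp (ENNReal.ofReal r) (hBm n) (measure_ne_top μ _) (c n)
    have hgn : ∀ n, ‖g n‖ ≤ (1/2:ℝ)^n := by
      intro n
      have hm := hB0 n
      rw [norm_indicatorConstLp (by simpa using hr0) (by simp), ENNReal.toReal_ofReal hr0.le,
        Real.norm_of_nonneg (hc0 n), hc]
      simp only
      rw [mul_assoc, ← Real.rpow_add hm]
      have e : -(1/2:ℝ) + 1 / r = a := by rw [ha]; ring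
      rw [e]
      have h1 := Real.rpow_le_rpow hm.le (hBlt n).le ha0.le
      rw [← Real.rpow_mul (by positivity), one_div_mul_cancel ha0.ne', Real.rpow_one] at h1
      rw [le_div_iff₀ (by positivity)] at h1
      linarith
    have hsum : Summable g := Summable.of_norm_bounded
      (summable_geometric_of_lt_one (by norm_num) (by norm_num)) hgn
    have hg0 : ∀ n, 0 ≤ g n := by
      intro n
      rw [← Lp.coeFn_nonneg]
      filter_upwards [indicatorConstLp_coeFn (p := ENNReal.ofReal r) (hs := hBm n)
        (hμs := measure_ne_top μ _) (c := c n)] with x hx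
      rw [hx]
      exact Set.indicator_nonneg (fun _ _ => hc0 n) x
    have hle : ∀ n, g n ≤ ∑' n, g n := fun n => hsum.le_tsum n (fun j _ => hg0 j)
    set f := ∑' n, g n with hf
    have hfin := hmul f (Lp.memLp f)
    have hb : ∀ n : ℕ, ENNReal.ofReal ((n+1) * ε) ≤ eLpNorm (fun x => (f x : ℂ) * ξ x) 2 μ := by
      intro n
      have hm := hB0 n
      have h1 : eLpNorm ((B n).indicator fun _ => c n * ε) 2 μ = ENNReal.ofReal ((n+1) * ε) := by
        rw [eLpNorm_indicator_const (hBm n) (by simp) (by simp),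
          Real.enorm_of_nonneg (mul_nonneg (hc0 n) hε0.le),
          ← ENNReal.ofReal_toReal (measure_ne_top μ (B n)),
          ENNReal.ofReal_rpow_of_pos (show 0 < (μ (B n)).toReal from hm), ← ENNReal.ofReal_mul (mul_nonneg (hc0 n) hε0.le)]
        congr 1
        have : (μ.real (B n)) ^ (-(1/2:ℝ)) * (μ.real (B n)) ^ (1/2:ℝ) = 1 := by
          rw [← Real.rpow_add hm]; simp
        change (n+1) * (μ.real (B n)) ^ (-(1/2:ℝ)) * ε * (μ.real (B n)) ^ (1/2:ℝ) = _
        linear_combination ((n+1) * ε) * this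
      rw [← h1]
      refine eLpNorm_mono_ae ?_
      filter_upwards [indicatorConstLp_coeFn (p := ENNReal.ofReal r) (hs := hBm n)
        (hμs := measure_ne_top μ _) (c := c n), (Lp.coeFn_le _ _).2 (hle n), hξη] with x hx hx2 hx3
      by_cases hxB : x ∈ B n
      · rw [hx, Set.indicator_of_mem hxB] at hx2
        rw [Set.indicator_of_mem hxB, norm_mul (c n) ε, hx3, norm_mul _ (η x), Complex.norm_real]
        have hA : ε < ‖η x‖ := hBA n hxB
        rw [Real.norm_of_nonneg (hc0 n), Real.norm_of_nonneg hε0.le,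
          Real.norm_of_nonneg ((hc0 n).trans hx2)]
        exact mul_le_mul hx2 hA.le hε0.le ((hc0 n).trans hx2)
      · rw [Set.indicator_of_notMem hxB]; simp only [norm_zero]; positivity
    obtain ⟨n, hn⟩ := exists_nat_gt ((eLpNorm (fun x => (f x : ℂ) * ξ x) 2 μ).toReal / ε)
    have h2 := (ENNReal.ofReal_le_iff_le_toReal hfin.2.ne).1 (hb n)
    rw [div_lt_iff₀ hε0] at hn
    nlinarith
  have h3 : ∀ᵐ x ∂μ, ∀ k : ℕ, ¬ (1 / ((k:ℝ) + 1) < ‖η x‖) := by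
    rw [ae_all_iff]
    intro k
    rw [ae_iff]
    simpa only [not_not] using key k
  filter_upwards [h3] with x hx
  by_contra hne
  obtain ⟨k, hk⟩ := exists_nat_one_div_lt (norm_pos_iff.2 hne)
  exact hx k hk
end

section
/- Let r > 2 and ξ ∈ L²([0,1],ℂ). Then the pointwise product f·ξ lies in L²([0,1],ℂ) for every f ∈ L^r([0,1],ℝ) if and only if ξ ∈ L^{2r/(r-2)}([0,1],ℂ). -/
open MeasureTheory
open scoped ENNReal

theorem unif_bd {α : Type*} [MeasurableSpace α] {μ : Measure α} {p : ℝ≥0∞} [Fact (1 ≤ p)]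
    {ξ : α → ℂ}
    (h : ∀ f : α → ℝ, MemLp f p μ → MemLp (fun x => (f x : ℂ) * ξ x) 2 μ) :
    ∃ k : ℕ, ∀ f : Lp ℝ p μ, 0 ≤ f →
      eLpNorm (fun x => (f x : ℂ) * ξ x) 2 μ ≤ (4 : ℝ≥0∞) ^ k * ‖f‖ₑ := by
  by_contra! hc
  choose f hf0 hf using hc
  have hne : ∀ k, f k ≠ 0 := by
    intro k hk
    have h1 := hf k
    have h2 : eLpNorm (fun x => (f k x : ℂ) * ξ x) 2 μ = 0 := by
      rw [eLpNorm_congr_ae (g := fun _ => (0:ℂ))]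
      · simp
      · rw [hk]
        filter_upwards [Lp.coeFn_zero ℝ p μ] with x hx
        rw [hx]
        simp
    rw [h2] at h1
    exact not_lt_bot h1
  have hn : ∀ k, 0 < ‖f k‖ := fun k => norm_pos_iff.2 (hne k)
  let c : ℕ → ℝ := fun k => (1/2 : ℝ)^k * ‖f k‖⁻¹
  have hc0 : ∀ k, 0 < c k := fun k => by have := hn k; positivity
  have hs : Summable (fun k => c k • f k) := by
    apply Summable.of_norm
    have : (fun k => ‖c k • f k‖) = fun k => (1/2 : ℝ)^k := by
      funext k
      rw [norm_smul, Real.norm_of_nonneg (hc0 k).le]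
      have := (hn k).ne'
      simp only [c]
      field_simp
    rw [this]
    exact summable_geometric_two
  have hpos : ∀ k, 0 ≤ c k • f k := by
    intro k
    rw [← Lp.coeFn_nonneg]
    filter_upwards [Lp.coeFn_smul (c k) (f k), (Lp.coeFn_nonneg _).2 (hf0 k)] with x h1 h2
    rw [h1]
    exact mul_nonneg (hc0 k).le h2
  set F := ∑' k, c k • f k with hF
  have hle : ∀ k, c k • f k ≤ F := fun k => hs.le_tsum k (fun j _ => hpos j)
  have hfin := (h F (Lp.memLp F)).eLpNorm_lt_top
  have key : ∀ k : ℕ, (2 : ℝ≥0∞)^k ≤ eLpNorm (fun x => (F x : ℂ) * ξ x) 2 μ := by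
    intro k
    calc (2 : ℝ≥0∞)^k = ‖c k‖ₑ * ((4:ℝ≥0∞)^k * ‖f k‖ₑ) := by
          have e4 : (4:ℝ≥0∞)^k = ENNReal.ofReal (4^k) := by
            rw [ENNReal.ofReal_pow (by norm_num)]; norm_num
          have e2 : (2:ℝ≥0∞)^k = ENNReal.ofReal (2^k) := by
            rw [ENNReal.ofReal_pow (by norm_num)]; norm_num
          rw [e4, e2, Real.enorm_of_nonneg (hc0 k).le, ← ofReal_norm, 
            ← ENNReal.ofReal_mul (by positivity), ← ENNReal.ofReal_mul (hc0 k).le]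
          congr 1
          have := (hn k).ne'
          simp only [c]
          field_simp
          rw [← mul_pow]; norm_num
      _ ≤ ‖c k‖ₑ * eLpNorm (fun x => (f k x : ℂ) * ξ x) 2 μ := by gcongr; exact (hf k).le
      _ = eLpNorm (c k • fun x => (f k x : ℂ) * ξ x) 2 μ := (eLpNorm_const_smul _ _ _ _).symm
      _ ≤ _ := by
          apply eLpNorm_mono_ae
          filter_upwards [Lp.coeFn_smul (c k) (f k), (Lp.coeFn_nonneg _).2 (hpos k),
            (Lp.coeFn_le _ _).2 (hle k)] with x h1 h2 h3
          rw [h1] at h2 h3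
          simp only [Pi.smul_apply, smul_eq_mul, Pi.zero_apply] at h2 h3
          simp only [Pi.smul_apply, Complex.real_smul]
          rw [← mul_assoc, ← Complex.ofReal_mul, norm_mul, norm_mul, Complex.norm_real,
            Complex.norm_real, Real.norm_of_nonneg h2, Real.norm_of_nonneg (h2.trans h3)]
          gcongr
  have := ENNReal.tendsto_pow_atTop_nhds_top_iff.2 (show (1:ℝ≥0∞) < 2 by norm_num)
  obtain ⟨k, hk⟩ := (this.eventually (lt_mem_nhds hfin)).exists
  exact absurd (key k) (not_le.2 hk)

theorem converse_holder {α : Type*} [MeasurableSpace α] {μ : Measure α} [IsFiniteMeasure μ]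
    (r s : ℝ) (hr : 2 < r) (hs : 0 < s) (hrs : 1 / 2 - 1 / r = 1 / s)
    {ξ : α → ℂ} (hξ : AEStronglyMeasurable ξ μ)
    (h : ∀ f : α → ℝ, MemLp f (ENNReal.ofReal r) μ → MemLp (fun x => (f x : ℂ) * ξ x) 2 μ) :
    MemLp ξ (ENNReal.ofReal s) μ := by
  have hr0 : 0 < r := by linarith
  haveI : Fact (1 ≤ ENNReal.ofReal r) := ⟨by
    rw [ENNReal.one_le_ofReal]; linarith⟩
  obtain ⟨K, hK⟩ := unif_bd h
  set C : ℝ≥0∞ := 4 ^ K with hC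
  have hCtop : C ≠ ∞ := by rw [hC]; exact ENNReal.pow_ne_top (by norm_num)
  let E : ℕ → Set α := fun n => {x | ‖ξ x‖ ≤ n}
  have hE : ∀ n, NullMeasurableSet (E n) μ := fun n =>
    nullMeasurableSet_le hξ.norm.aemeasurable aemeasurable_const
  let u : ℕ → α → ℝ := fun n => (E n).indicator (fun x => ‖ξ x‖ ^ (s / r))
  let A : ℕ → ℝ≥0∞ := fun n => ∫⁻ x in E n, ‖ξ x‖ₑ ^ s ∂μ
  have hu0 : ∀ n x, 0 ≤ u n x := fun n x => Set.indicator_nonneg (fun _ _ => by positivity) _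
  have hu : ∀ n, MemLp (u n) (ENNReal.ofReal r) μ := by
    intro n
    apply MemLp.of_bound (C := (n:ℝ) ^ (s/r))
    · exact AEStronglyMeasurable.indicator₀
        (hξ.norm.aemeasurable.pow_const _).aestronglyMeasurable (hE n)
    · refine Filter.Eventually.of_forall fun x => ?_
      rw [Real.norm_of_nonneg (hu0 n x)]
      apply Set.indicator_le' (f := fun x => ‖ξ x‖ ^ (s / r)) (g := fun _ => (n:ℝ) ^ (s/r))
      · intro y hy
        exact Real.rpow_le_rpow (norm_nonneg _) hy (by positivity)
      · intro y _
        positivity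
  have hun : ∀ n, eLpNorm (u n) (ENNReal.ofReal r) μ = A n ^ (1/r) := by
    intro n
    rw [eLpNorm_eq_lintegral_rpow_enorm_toReal (by simpa using hr0) ENNReal.ofReal_ne_top,
      ENNReal.toReal_ofReal hr0.le]
    congr 1
    simp only [A]
    rw [← lintegral_indicator₀ (hE n)]
    congr 1
    funext x
    by_cases hx : x ∈ E n
    · simp only [u, Set.indicator_of_mem hx]
      rw [Real.enorm_rpow_of_nonneg (norm_nonneg _) (by positivity), enorm_norm,
        ← ENNReal.rpow_mul]
      congr 1
      field_simp
    · simp [u, Set.indicator_of_notMem hx, hr0]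
  have hux : ∀ n, eLpNorm (fun x => (u n x : ℂ) * ξ x) 2 μ = A n ^ (1/2 : ℝ) := by
    intro n
    rw [eLpNorm_eq_lintegral_rpow_enorm_toReal (by simp) (by simp)]
    simp only [ENNReal.toReal_ofNat]
    congr 1
    simp only [A]
    rw [← lintegral_indicator₀ (hE n)]
    congr 1
    funext x
    by_cases hx : x ∈ E n
    · simp only [u, Set.indicator_of_mem hx]
      have e : ‖((‖ξ x‖ ^ (s / r) : ℝ) : ℂ)‖ₑ = ‖ξ x‖ₑ ^ (s/r) := by
        rw [← enorm_norm, Complex.norm_real, enorm_norm,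
          Real.enorm_rpow_of_nonneg (norm_nonneg _) (by positivity), enorm_norm]
      rw [enorm_mul, e, ENNReal.mul_rpow_of_nonneg _ _ (by norm_num), ← ENNReal.rpow_mul,
        ← ENNReal.rpow_add_of_nonneg _ _ (by positivity) (by norm_num)]
      congr 1
      field_simp at hrs ⊢
      linarith
    · simp [u, Set.indicator_of_notMem hx]
  have hA : ∀ n, A n ≤ C ^ s := by
    intro n
    have h1 := hK ((hu n).toLp) (by
      rw [← Lp.coeFn_nonneg]
      filter_upwards [(hu n).coeFn_toLp] with x hx
      rw [hx]; exact hu0 n x)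
    rw [Lp.enorm_toLp, hun, eLpNorm_congr_ae (g := fun x => (u n x : ℂ) * ξ x) (by
      filter_upwards [(hu n).coeFn_toLp] with x hx
      rw [hx]), hux] at h1
    have hAt : A n ≠ ∞ := by
      intro ht
      have := (hu n).eLpNorm_lt_top
      rw [hun, ht, ENNReal.top_rpow_of_pos (by positivity)] at this
      exact lt_irrefl _ this
    by_cases hA0 : A n = 0
    · rw [hA0]; exact zero_le
    have h2 : A n ^ (1/s) ≤ C := by
      rw [← hrs, ENNReal.rpow_sub _ _ hA0 hAt]
      exact ENNReal.div_le_of_le_mul h1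
    calc A n = (A n ^ (1/s))^s := by
          rw [← ENNReal.rpow_mul, one_div_mul_cancel hs.ne', ENNReal.rpow_one]
      _ ≤ _ := ENNReal.rpow_le_rpow h2 hs.le
  refine ⟨hξ, ?_⟩
  rw [eLpNorm_lt_top_iff_lintegral_rpow_enorm_lt_top (by simpa using hs) ENNReal.ofReal_ne_top,
    ENNReal.toReal_ofReal hs.le]
  have hun : (⋃ n, E n) = Set.univ := by
    ext x
    simp only [Set.mem_iUnion, Set.mem_univ, iff_true]
    exact exists_nat_ge ‖ξ x‖
  have hmono : Monotone E := fun m n hmn x (hx : ‖ξ x‖ ≤ m) =>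
    show ‖ξ x‖ ≤ n from hx.trans (by exact_mod_cast hmn)
  rw [← setLIntegral_univ, ← hun, setLIntegral_iUnion_of_directed _ hmono.directed_le]
  exact (iSup_le hA).trans_lt (ENNReal.rpow_lt_top_of_nonneg hs.le hCtop)

/-- For `r > 2` and `ξ ∈ L²([0,1],ℂ)`, the pointwise product `f·ξ` lies in
`L²([0,1],ℂ)` for every `f ∈ L^r([0,1],ℝ)` if and only if
`ξ ∈ L^{2r/(r-2)}([0,1],ℂ)`. -/
theorem stmt14
    (r : ℝ) (hr : 2 < r)
    (ξ : Set.Icc (0:ℝ) 1 → ℂ)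
    (hξ : MemLp ξ 2 (volume : Measure (Set.Icc (0:ℝ) 1))) :
    (∀ f : Set.Icc (0:ℝ) 1 → ℝ,
        MemLp f (ENNReal.ofReal r) (volume : Measure (Set.Icc (0:ℝ) 1)) →
        MemLp (fun x => (f x : ℂ) * ξ x) 2 (volume : Measure (Set.Icc (0:ℝ) 1))) ↔
      MemLp ξ (ENNReal.ofReal (2 * r / (r - 2)))
        (volume : Measure (Set.Icc (0:ℝ) 1)) := by
  have hr2 : 0 < r - 2 := by linarith
  have hr0 : 0 < r := by linarith
  have hs : 0 < 2 * r / (r - 2) := by positivity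
  have hrs : 1 / 2 - 1 / r = 1 / (2 * r / (r - 2)) := by field_simp
  constructor
  · exact converse_holder r _ hr hs hrs hξ.1
  · intro h f hf
    haveI : ENNReal.HolderTriple (ENNReal.ofReal r) (ENNReal.ofReal (2 * r / (r - 2))) 2 := by
      constructor
      rw [← ENNReal.ofReal_inv_of_pos hr0, ← ENNReal.ofReal_inv_of_pos hs,
        ← ENNReal.ofReal_add (by positivity) (by positivity)]
      have : r⁻¹ + (2 * r / (r - 2))⁻¹ = (2:ℝ)⁻¹ := by
        rw [inv_eq_one_div (2 * r / (r - 2)), ← hrs]; ring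
      rw [this, ENNReal.ofReal_inv_of_pos (by norm_num)]
      norm_num
    exact MemLp.mul' h hf.ofReal
end

section
/- Let G be a topological group, (Nᵢ)_{i∈I} a filter basis of closed normal subgroups of G with lim Nᵢ = {1}, i.e., every neighborhood of the identity in G contains some Nᵢ. Let (π, H) be a continuous unitary representation of G on a complex Hilbert space H. Then the union ⋃_{i∈I} H^{Nᵢ} of the closed subspaces H^{Nᵢ} = {v ∈ H : π(n)v = v for all n ∈ Nᵢ} of Nᵢ-fixed vectors is dense in H. -/
/-- Let `G` be a topological group, `(Nᵢ)` a filter basis of closed normal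
subgroups with `lim Nᵢ = {1}` (every identity neighborhood contains some `Nᵢ`), and
`(π, H)` a continuous unitary representation of `G`. Then the union of the subspaces
`H^{Nᵢ}` of `Nᵢ`-fixed vectors is dense in `H`. -/
theorem stmt17
    {G : Type*} [Group G] [TopologicalSpace G] [IsTopologicalGroup G]
    {I : Type*} [Nonempty I] (N : I → Subgroup G)
    (hclosed : ∀ i, IsClosed (N i : Set G))
    (hnormal : ∀ i, (N i).Normal)
    (hbasis : ∀ i j, ∃ k, N k ≤ N i ⊓ N j)
    (hlim : ∀ U ∈ nhds (1 : G), ∃ i, (N i : Set G) ⊆ U)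
    {H : Type*} [NormedAddCommGroup H] [InnerProductSpace ℂ H] [CompleteSpace H]
    (π : G →* (H ≃ₗᵢ[ℂ] H))
    (hcont : Continuous fun p : G × H => π p.1 p.2) :
    Dense (⋃ i, {v : H | ∀ n ∈ N i, π n v = v}) := by
  intro v
  rw [Metric.mem_closure_iff]
  intro ε hε
  have hc : Continuous fun g : G => π g v := hcont.comp (by fun_prop : Continuous fun g : G => (g, v))
  have hU : {g : G | dist (π g v) v < ε / 2} ∈ nhds (1 : G) := by
    apply (isOpen_lt (hc.dist continuous_const) continuous_const).mem_nhds
    simp [hε]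
  obtain ⟨i, hi⟩ := hlim _ hU
  letI : InnerProductSpace ℝ H := InnerProductSpace.rclikeToReal ℂ H
  let K : Set H := ⋂ n ∈ N i, Metric.closedBall (π n v) (ε / 2)
  have memK : ∀ x, x ∈ K ↔ ∀ n ∈ N i, dist x (π n v) ≤ ε / 2 := by
    intro x
    simp [K]
  have hKc : Convex ℝ K := convex_iInter₂ fun n _ => convex_closedBall _ _
  have hKcl : IsClosed K := isClosed_biInter fun n _ => Metric.isClosed_closedBall
  have hvK : v ∈ K := by
    rw [memK]
    intro n hn
    rw [dist_comm]
    exact (hi hn).le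
  obtain ⟨w, hw, hmin⟩ := exists_norm_eq_iInf_of_complete_convex ⟨v, hvK⟩ hKcl.isComplete hKc 0
  rw [norm_eq_iInf_iff_real_inner_le_zero hKc hw] at hmin
  refine ⟨w, Set.mem_iUnion.2 ⟨i, ?_⟩, ?_⟩
  · intro n hn
    have hx : π n w ∈ K := by
      rw [memK]
      intro m hm
      have h1 := (memK w).1 hw (n⁻¹ * m) ((N i).mul_mem ((N i).inv_mem hn) hm)
      have h2 : π m v = π n (π (n⁻¹ * m) v) := by
        have h3 : π m = π n * π (n⁻¹ * m) := by rw [← map_mul, mul_inv_cancel_left]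
        rw [h3]
        rfl
      rw [h2, LinearIsometryEquiv.dist_map]
      exact h1
    have h := hmin _ hx
    have hn' : ‖π n w‖ = ‖w‖ := LinearIsometryEquiv.norm_map _ _
    have e := norm_sub_sq_real (π n w) w
    rw [zero_sub, inner_neg_left, inner_sub_right, real_inner_self_eq_norm_sq,
      real_inner_comm] at h
    rw [hn'] at e
    have : ‖π n w - w‖ ^ 2 ≤ 0 := by linarith
    have h0 : ‖π n w - w‖ = 0 := by
      have := sq_nonneg ‖π n w - w‖
      exact pow_eq_zero_iff (two_ne_zero) |>.1 (by linarith)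
    exact sub_eq_zero.1 (norm_eq_zero.1 h0)
  · have h1 := (memK w).1 hw 1 (N i).one_mem
    rw [map_one, dist_comm] at h1
    change dist v w ≤ ε / 2 at h1
    linarith
end

section
/- Let G be a topological group, (Nᵢ)_{i∈I} a filter basis of closed normal subgroups of G with lim Nᵢ = {1}, i.e., every neighborhood of the identity in G contains some Nᵢ. Then every continuous unitary representation (π, H) of G on a complex Hilbert space H is a direct sum of subrepresentations on each of which some Nᵢ acts trivially: there exists a family (H_j)_{j∈J} of pairwise orthogonal closed G-invariant subspaces of H whose closed linear span is all of H, such that for each j ∈ J there is some i ∈ I with π(n)v = v for all n ∈ Nᵢ and v ∈ H_j. -/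
universe u

theorem min_aux {H : Type*} [NormedAddCommGroup H] [InnerProductSpace ℝ H] [CompleteSpace H]
    (C : Set H) (hne : C.Nonempty) (hCc : IsClosed C) (hCx : Convex ℝ C) :
    ∃ w ∈ C, ∀ f : H → H, (∀ x ∈ C, f x ∈ C) → (∀ x, ‖f x‖ = ‖x‖) → f w = w := by
  obtain ⟨w, hwC, hw⟩ := exists_norm_eq_iInf_of_complete_convex hne hCc.isComplete hCx 0
  have hin := (norm_eq_iInf_iff_real_inner_le_zero hCx hwC).1 hw
  refine ⟨w, hwC, fun f hf hn => ?_⟩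
  have h1 := hin _ (hf w hwC)
  have h2 : ‖f w‖ = ‖w‖ := hn w
  have h3 := norm_sub_sq_real (f w) w
  rw [zero_sub, inner_neg_left, inner_sub_right, real_inner_self_eq_norm_sq,
    real_inner_comm] at h1
  rw [h2] at h3
  have h4 : ‖f w - w‖ ^ 2 = 0 := le_antisymm (by linarith) (sq_nonneg _)
  exact sub_eq_zero.1 (norm_eq_zero.1 ((pow_eq_zero_iff two_ne_zero).1 h4))

theorem fixed_aux {H : Type*} [NormedAddCommGroup H] [InnerProductSpace ℂ H] [CompleteSpace H]
    {M : Type*} [Group M] (ρ : M →* (H ≃ₗᵢ[ℂ] H)) (W : Submodule ℂ H) (hWc : IsClosed (W : Set H))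
    (hW : ∀ g, ∀ v ∈ W, ρ g v ∈ W) (v : H) (hv : v ∈ W) (hv0 : v ≠ 0)
    (hs : ∀ g, ‖ρ g v - v‖ ≤ ‖v‖ / 2) :
    ∃ w ∈ W, w ≠ 0 ∧ ∀ g, ρ g w = w := by
  letI : InnerProductSpace ℝ H := InnerProductSpace.complexToReal
  set O : Set H := Set.range fun g => ρ g v with hO
  set C : Set H := closedConvexHull ℝ O with hC
  have hOC : O ⊆ C := subset_closedConvexHull
  have hCc : IsClosed C := isClosed_closedConvexHull
  have hCx : Convex ℝ C := convex_closedConvexHull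
  have hCW : C ⊆ (W : Set H) := by
    apply closedConvexHull_min
    · rintro _ ⟨g, rfl⟩
      exact hW g v hv
    · exact (W.restrictScalars ℝ).convex
    · exact hWc
  have hCB : C ⊆ Metric.closedBall v (‖v‖ / 2) := by
    apply closedConvexHull_min
    · rintro _ ⟨g, rfl⟩
      simpa [dist_eq_norm] using hs g
    · exact convex_closedBall _ _
    · exact Metric.isClosed_closedBall
  have hCinv : ∀ g, ∀ x ∈ C, ρ g x ∈ C := by
    intro g
    have : C ⊆ (ρ g) ⁻¹' C := by
      apply closedConvexHull_min
      · rintro _ ⟨h, rfl⟩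
        apply hOC
        exact ⟨g * h, by simp⟩
      · exact hCx.linear_preimage ((ρ g).toLinearEquiv.toLinearMap.restrictScalars ℝ)
      · exact hCc.preimage (ρ g).continuous
    exact this
  have hne : C.Nonempty := ⟨ρ 1 v, hOC ⟨1, rfl⟩⟩
  obtain ⟨w, hwC, hw⟩ := min_aux C hne hCc hCx
  refine ⟨w, hCW hwC, ?_, ?_⟩
  · rintro rfl
    have := hCB hwC
    have h2 : 0 < ‖v‖ := norm_pos_iff.2 hv0
    simp only [Metric.mem_closedBall, dist_zero_left] at this
    linarith
  · intro g
    exact hw _ (hCinv g) (ρ g).norm_map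

/-- Let `G` be a topological group, `(Nᵢ)` a filter basis of closed normal
subgroups with `lim Nᵢ = {1}`. Then every continuous unitary representation `(π, H)` of
`G` is a direct sum of subrepresentations on each of which some `Nᵢ` acts trivially:
there is a family of pairwise orthogonal closed `G`-invariant subspaces whose closed
linear span is `H`, each pointwise fixed by some `Nᵢ`. -/
theorem stmt18
    {G : Type*} [Group G] [TopologicalSpace G] [IsTopologicalGroup G]
    {I : Type*} [Nonempty I] (N : I → Subgroup G)
    (hclosed : ∀ i, IsClosed (N i : Set G))
    (hnormal : ∀ i, (N i).Normal)
    (hbasis : ∀ i j, ∃ k, N k ≤ N i ⊓ N j)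
    (hlim : ∀ U ∈ nhds (1 : G), ∃ i, (N i : Set G) ⊆ U)
    {H : Type u} [NormedAddCommGroup H] [InnerProductSpace ℂ H] [CompleteSpace H]
    (π : G →* (H ≃ₗᵢ[ℂ] H))
    (hcont : Continuous fun p : G × H => π p.1 p.2) :
    ∃ (J : Type u) (K : J → Submodule ℂ H),
      (∀ j, IsClosed (K j : Set H)) ∧
      (∀ j (g : G) (v : H), v ∈ K j → π g v ∈ K j) ∧
      (∀ j j', j ≠ j' → ∀ v ∈ K j, ∀ w ∈ K j', (inner ℂ v w : ℂ) = 0) ∧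
      (⨆ j, K j).topologicalClosure = ⊤ ∧
      (∀ j, ∃ i, ∀ n ∈ N i, ∀ v ∈ K j, π n v = v) := by
  classical
  let good : Submodule ℂ H → Prop := fun K => IsClosed (K : Set H) ∧
    (∀ (g : G) (v : H), v ∈ K → π g v ∈ K) ∧ ∃ i, ∀ n ∈ N i, ∀ v ∈ K, π n v = v
  let P : Set (Set (Submodule ℂ H)) := {s | (∀ K ∈ s, good K) ∧
    s.Pairwise fun A B => ∀ v ∈ A, ∀ w ∈ B, (inner ℂ v w : ℂ) = 0}
  obtain ⟨s, hs⟩ : ∃ s, Maximal (· ∈ P) s := by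
    apply zorn_subset
    intro c hcP hc
    refine ⟨⋃₀ c, ⟨?_, ?_⟩, fun s hs => Set.subset_sUnion_of_mem hs⟩
    · rintro K ⟨t, ht, hK⟩
      exact (hcP ht).1 K hK
    · exact (Set.pairwise_sUnion hc.directedOn).2 fun t ht => (hcP ht).2
  have hsP : s ∈ P := hs.prop
  refine ⟨s, fun K => K.1, fun K => (hsP.1 K.1 K.2).1, fun K => (hsP.1 K.1 K.2).2.1, ?_, ?_,
    fun K => (hsP.1 K.1 K.2).2.2⟩
  · intro A B hAB
    exact hsP.2 A.2 B.2 fun h => hAB (Subtype.ext h)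
  rw [Submodule.topologicalClosure_eq_top_iff]
  by_contra hbot
  set W : Submodule ℂ H := (⨆ j : s, j.1)ᗮ with hWdef
  have hWmem : ∀ v, v ∈ W ↔ ∀ K ∈ s, ∀ x ∈ K, (inner ℂ x v : ℂ) = 0 := by
    intro v
    rw [hWdef, ← Submodule.iInf_orthogonal]
    simp [Submodule.mem_orthogonal]
  have hWinv : ∀ (g : G), ∀ v ∈ W, π g v ∈ W := by
    intro g v hv
    rw [hWmem] at hv ⊢
    intro K hK x hx
    have h1 := hv K hK _ ((hsP.1 K hK).2.1 g⁻¹ x hx)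
    rw [← (π g).inner_map_map] at h1
    have h2 : π g (π g⁻¹ x) = x := by
      have : (π g * π g⁻¹) x = x := by rw [← map_mul]; simp
      exact this
    rwa [h2] at h1
  have hWc : IsClosed (W : Set H) := Submodule.isClosed_orthogonal _
  obtain ⟨v, hv, hv0⟩ := Submodule.exists_mem_ne_zero_of_ne_bot hbot
  have hcv : Continuous fun g : G => ‖π g v - v‖ := by
    have : Continuous fun g : G => π g v := hcont.comp (Continuous.prodMk_left v)
    exact (this.sub continuous_const).norm
  have hpos : 0 < ‖v‖ / 2 := half_pos (norm_pos_iff.2 hv0)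
  obtain ⟨i, hi⟩ := hlim {g | ‖π g v - v‖ < ‖v‖ / 2}
    ((isOpen_lt hcv continuous_const).mem_nhds (by simpa using hv0))
  obtain ⟨w, hwW, hw0, hw⟩ := fixed_aux (π.comp (N i).subtype) W hWc
    (fun g => hWinv g) v hv hv0 (fun g => le_of_lt (hi g.2))
  let F : Submodule ℂ H :=
    { carrier := {x | ∀ n ∈ N i, π n x = x}
      add_mem' := fun {a b} ha hb n hn => by rw [map_add, ha n hn, hb n hn]
      zero_mem' := fun n _ => map_zero _
      smul_mem' := fun c x hx n hn => by rw [map_smul, hx n hn] }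
  have hFc : IsClosed (F : Set H) := by
    have : (F : Set H) = ⋂ n ∈ N i, {x | π n x = x} := by
      ext x
      simp only [Set.mem_iInter]
      rfl
    rw [this]
    exact isClosed_biInter fun n _ => isClosed_eq (π n).continuous continuous_id
  have hFinv : ∀ (g : G), ∀ x ∈ F, π g x ∈ F := by
    intro g x hx n hn
    have h1 := hx _ ((hnormal i).conj_mem n hn g⁻¹)
    rw [inv_inv] at h1
    have h2 : π g (π (g⁻¹ * n * g) x) = π n (π g x) := by
      have : (π g * π (g⁻¹ * n * g)) x = (π n * π g) x := by
        rw [← map_mul, ← map_mul]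
        congr 2
        group
      exact this
    rw [← h2, h1]
  have hnew : insert (W ⊓ F) s ∈ P := by
    refine ⟨?_, ?_⟩
    · rintro K (rfl | hK)
      · exact ⟨hWc.inter hFc, fun g x hx => ⟨hWinv g x hx.1, hFinv g x hx.2⟩,
          i, fun n hn x hx => hx.2 n hn⟩
      · exact hsP.1 K hK
    · refine hsP.2.insert fun K hK _ => ⟨fun x hx y hy => ?_, fun x hx y hy => ?_⟩
      · exact inner_eq_zero_symm.1 ((hWmem x).1 hx.1 K hK y hy)
      · exact (hWmem y).1 hy.1 K hK x hx
  have hmem : W ⊓ F ∈ s := hs.le_of_ge hnew (Set.subset_insert _ _) (Set.mem_insert _ _)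
  have hwF : w ∈ W ⊓ F := ⟨hwW, fun n hn => hw ⟨n, hn⟩⟩
  exact hw0 (inner_self_eq_zero.1 ((hWmem w).1 hwW _ hmem w hwF))
end

section
/- Let G be a topological group and (Nᵢ)_{i∈I} a filter basis of closed normal subgroups of G with lim Nᵢ = {1}, i.e., every neighborhood of the identity in G contains some Nᵢ. Then every irreducible continuous unitary representation (π, H) of G factors through some quotient G/Nᵢ; that is, there exists i ∈ I with Nᵢ ⊆ ker π, i.e., π(n) = id_H for all n ∈ Nᵢ. -/
theorem exists_min_norm_aux {H : Type*} [NormedAddCommGroup H] [InnerProductSpace ℂ H]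
    [CompleteSpace H] {C : Set H} (hCne : C.Nonempty) (hCcl : IsClosed C)
    (hCconv : Convex ℝ C) : ∃ w ∈ C, ∀ x ∈ C, ‖x‖ = ‖w‖ → x = w := by
  letI : InnerProductSpace ℝ H := InnerProductSpace.complexToReal
  obtain ⟨w, hwC, hw⟩ :=
    exists_norm_eq_iInf_of_complete_convex hCne hCcl.isComplete hCconv (0 : H)
  have hmin : ∀ x ∈ C, ‖w‖ ≤ ‖x‖ := by
    intro x hx
    have h : ‖(0 : H) - w‖ ≤ ‖(0 : H) - x‖ := by
      rw [hw]
      exact ciInf_le (f := fun y : C => ‖(0 : H) - y‖)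
        ⟨0, by rintro _ ⟨y, rfl⟩; exact norm_nonneg _⟩ ⟨x, hx⟩
    simpa using h
  have huniq : ∀ x ∈ C, ‖x‖ = ‖w‖ → x = w := by
    intro x hx hxn
    have hm : (1 / 2 : ℝ) • x + (1 / 2 : ℝ) • w ∈ C :=
      hCconv hx hwC (by norm_num) (by norm_num) (by norm_num)
    have h1 := hmin _ hm
    rw [← smul_add, norm_smul] at h1
    norm_num at h1
    have h2 := parallelogram_law_with_norm ℂ x w
    rw [hxn] at h2
    have h3 : ‖x - w‖ = 0 := by
      nlinarith [norm_nonneg (x - w), norm_nonneg w, norm_nonneg (x + w)]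
    exact sub_eq_zero.mp (norm_eq_zero.mp h3)
  exact ⟨w, hwC, huniq⟩

/-- Let `G` be a topological group and `(Nᵢ)` a filter basis of closed normal
subgroups with `lim Nᵢ = {1}`. Then every irreducible continuous unitary representation
`(π, H)` of `G` factors through some `G/Nᵢ`: there is `i` with `π(n) = id` for all
`n ∈ Nᵢ`. -/
theorem stmt19
    {G : Type*} [Group G] [TopologicalSpace G] [IsTopologicalGroup G]
    {I : Type*} [Nonempty I] (N : I → Subgroup G)
    (hclosed : ∀ i, IsClosed (N i : Set G))
    (hnormal : ∀ i, (N i).Normal)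
    (hbasis : ∀ i j, ∃ k, N k ≤ N i ⊓ N j)
    (hlim : ∀ U ∈ nhds (1 : G), ∃ i, (N i : Set G) ⊆ U)
    {H : Type*} [NormedAddCommGroup H] [InnerProductSpace ℂ H] [CompleteSpace H]
    [Nontrivial H]
    (π : G →* (H ≃ₗᵢ[ℂ] H))
    (hcont : Continuous fun p : G × H => π p.1 p.2)
    (hirr : ∀ K : Submodule ℂ H, IsClosed (K : Set H) →
      (∀ (g : G) (v : H), v ∈ K → π g v ∈ K) → K = ⊥ ∨ K = ⊤) :
    ∃ i, ∀ n ∈ N i, ∀ v : H, π n v = v := by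
  obtain ⟨v, hv⟩ := exists_ne (0 : H)
  have hv0 : 0 < ‖v‖ := norm_pos_iff.mpr hv
  have hcv : Continuous fun g : G => π g v :=
    hcont.comp (continuous_id.prodMk continuous_const)
  have hU : {g : G | ‖π g v - v‖ < ‖v‖ / 2} ∈ nhds (1 : G) := by
    apply (isOpen_lt (hcv.sub continuous_const).norm continuous_const).mem_nhds
    simp [hv0]
  obtain ⟨i, hi⟩ := hlim _ hU
  -- the fixed space of `N i`
  let K : Submodule ℂ H :=
    { carrier := {w | ∀ n ∈ N i, π n w = w}
      add_mem' := fun {a b} ha hb n hn => by rw [map_add, ha n hn, hb n hn]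
      zero_mem' := fun n _ => map_zero _
      smul_mem' := fun c a ha n hn => by rw [map_smul, ha n hn] }
  have hKmem : ∀ w, w ∈ K ↔ ∀ n ∈ N i, π n w = w := fun w => Iff.rfl
  have hKc : IsClosed (K : Set H) := by
    have : (K : Set H) = ⋂ n ∈ N i, {w | π n w = w} := by
      ext w; simp [hKmem]
    rw [this]
    exact isClosed_biInter fun n _ => isClosed_eq (π n).continuous continuous_id
  have hKinv : ∀ (g : G) (w : H), w ∈ K → π g w ∈ K := by
    intro g w hw n hn
    have h1 := hw (g⁻¹ * n * g) (by simpa using (hnormal i).conj_mem n hn g⁻¹)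
    have h2 : n * g = g * (g⁻¹ * n * g) := by group
    calc π n (π g w) = π (n * g) w := by rw [map_mul]; rfl
      _ = π g (π (g⁻¹ * n * g) w) := by rw [h2, map_mul]; rfl
      _ = π g w := by rw [h1]
  rcases hirr K hKc hKinv with hK | hK
  swap
  · exact ⟨i, fun n hn w => (hKmem w).1 (hK ▸ Submodule.mem_top) n hn⟩
  exfalso
  let S : Set H := (fun g : G => π g v) '' (N i : Set G)
  let C : Set H := closure (convexHull ℝ S)
  have hSC : S ⊆ C := (subset_convexHull ℝ S).trans subset_closure
  have hCconv : Convex ℝ C := (convex_convexHull ℝ S).closure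
  have hCcl : IsClosed C := isClosed_closure
  have hCmin : ∀ D : Set H, IsClosed D → Convex ℝ D → S ⊆ D → C ⊆ D := fun D h1 h2 h3 =>
    closure_minimal (convexHull_min h3 h2) h1
  have hCne : C.Nonempty := ⟨π 1 v, hSC ⟨1, (N i).one_mem, rfl⟩⟩
  have hCball : C ⊆ Metric.closedBall v (‖v‖ / 2) := by
    apply hCmin _ Metric.isClosed_closedBall (convex_closedBall _ _)
    rintro _ ⟨n, hn, rfl⟩
    rw [mem_closedBall_iff_norm]
    exact le_of_lt (hi hn)
  obtain ⟨w, hwC, huniq⟩ := exists_min_norm_aux hCne hCcl hCconv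
  have hwK : w ∈ K := by
    intro n hn
    refine huniq _ ?_ ((π n).norm_map w)
    have : C ⊆ (fun x => π n x) ⁻¹' C := by
      apply hCmin
      · exact hCcl.preimage (π n).continuous
      · intro x hx y hy a b ha hb hab
        have h := hCconv hx hy ha hb hab
        have e : π n (a • x + b • y) = a • π n x + b • π n y := by
          rw [map_add, ← Complex.coe_smul, ← Complex.coe_smul, map_smul, map_smul,
            Complex.coe_smul, Complex.coe_smul]
        simpa only [Set.mem_preimage, e] using h
      · rintro _ ⟨m, hm, rfl⟩
        apply hSC
        exact ⟨n * m, (N i).mul_mem hn hm, by simp only [map_mul]; rfl⟩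
    exact this hwC
  rw [hK, Submodule.mem_bot] at hwK
  have h := hCball hwC
  rw [hwK, mem_closedBall_iff_norm, zero_sub, norm_neg] at h
  linarith
end
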